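/- Let α > 1, δ > 0, and let F : ℝ² → ℝ be Lipschitz continuous with Lipschitz constant L. Let u : ℝ² → ℝ be twice continuously differentiable, satisfy |u(y)| ≤ C₀(|y| + 1/δ) for all y ∈ ℝ² for some C₀ > 0, and solve δ u(y) − (∂²u/∂y₁²(y) + y₁² ∂²u/∂y₂²(y)) + α y·∇u(y) = F(y) for all y ∈ ℝ². Then for every L̄ > L/(α − 1) one has |u(x) − u(y)| ≤ L̄ |x − y| for all x, y ∈ ℝ². In particular the Lipschitz bound is independent of δ. -/

import Mathlib

/-- Euclidean norm on `ℝ²`. -/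
noncomputable def nrm (p : ℝ × ℝ) : ℝ := Real.sqrt (p.1 ^ 2 + p.2 ^ 2)

/-- First partial derivative `∂u/∂y₁`. -/
noncomputable def pd1 (u : ℝ × ℝ → ℝ) (p : ℝ × ℝ) : ℝ := deriv (fun t => u (t, p.2)) p.1

/-- First partial derivative `∂u/∂y₂`. -/
noncomputable def pd2 (u : ℝ × ℝ → ℝ) (p : ℝ × ℝ) : ℝ := deriv (fun t => u (p.1, t)) p.2

/-- Second partial derivative `∂²u/∂y₁²`. -/
noncomputable def pd11 (u : ℝ × ℝ → ℝ) (p : ℝ × ℝ) : ℝ := deriv (fun t => pd1 u (t, p.2)) p.1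

/-- Second partial derivative `∂²u/∂y₂²`. -/
noncomputable def pd22 (u : ℝ × ℝ → ℝ) (p : ℝ × ℝ) : ℝ := deriv (fun t => pd2 u (p.1, t)) p.2

/-- The Grushin–Ornstein–Uhlenbeck operator
`u ↦ −(∂²u/∂y₁² + y₁² ∂²u/∂y₂²) + α y·∇u` on `ℝ²`. -/
noncomputable def GOU (α : ℝ) (u : ℝ × ℝ → ℝ) (p : ℝ × ℝ) : ℝ :=
  -(pd11 u p + p.1 ^ 2 * pd22 u p) + α * (p.1 * pd1 u p + p.2 * pd2 u p)

/-- Second order necessary condition at a maximum of a real `C²` function. -/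
theorem deriv_deriv_nonpos_of_forall_le {h : ℝ → ℝ} (hh : ContDiff ℝ 2 h) {t₀ : ℝ}
    (hmax : ∀ t, h t ≤ h t₀) : deriv (deriv h) t₀ ≤ 0 := by
  by_contra! hpos
  have hloc : IsLocalMax h t₀ := Filter.Eventually.of_forall hmax
  have hmin : IsLocalMin h t₀ :=
    isLocalMin_of_deriv_deriv_pos hpos hloc.deriv_eq_zero hh.continuous.continuousAt
  have hconst : h =ᶠ[nhds t₀] fun _ => h t₀ := by
    filter_upwards [hmin] with t ht using le_antisymm (hmax t) ht
  have hzero : deriv (deriv h) t₀ = 0 := by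
    rw [hconst.deriv.deriv_eq]
    simp
  exact hpos.ne' hzero

/-- First and second order conditions when `t ↦ a (p + k t) - b (q + l t) - (B t + C t²)`
is maximal at `t = 0`. -/
theorem optimality_of_quadratic_bound {a b : ℝ → ℝ} (ha : ContDiff ℝ 2 a) (hb : ContDiff ℝ 2 b)
    (p q k l B C : ℝ)
    (hmax : ∀ t, a (p + k * t) - b (q + l * t) - (B * t + C * t ^ 2) ≤ a p - b q) :
    k * deriv a p - l * deriv b q = B ∧
      k ^ 2 * deriv (deriv a) p - l ^ 2 * deriv (deriv b) q ≤ 2 * C := by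
  have hline : ∀ c d t : ℝ, HasDerivAt (fun s => c + d * s) d t := fun c d t => by
    simpa using ((hasDerivAt_id t).const_mul d).const_add c
  have hcomp : ∀ {f : ℝ → ℝ}, Differentiable ℝ f → ∀ c d t : ℝ,
      HasDerivAt (fun s => f (c + d * s)) (deriv f (c + d * t) * d) t := fun hf c d t =>
    HasDerivAt.comp t (hf (c + d * t)).hasDerivAt (hline c d t)
  have ha' : Differentiable ℝ (deriv a) :=
    (ContDiff.deriv' (n := 1) (by simpa [one_add_one_eq_two] using ha)).differentiable (by simp)
  have hb' : Differentiable ℝ (deriv b) :=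
    (ContDiff.deriv' (n := 1) (by simpa [one_add_one_eq_two] using hb)).differentiable (by simp)
  set h : ℝ → ℝ := fun t => a (p + k * t) - b (q + l * t) - (B * t + C * t ^ 2) with h_def
  have hh : ContDiff ℝ 2 h := by fun_prop
  have hle : ∀ t, h t ≤ h 0 := fun t => by simpa [h_def] using hmax t
  have hd : ∀ t, HasDerivAt h (deriv a (p + k * t) * k - deriv b (q + l * t) * l
      - (B + 2 * C * t)) t := fun t => by
    have hquad : HasDerivAt (fun s : ℝ => B * s + C * s ^ 2) (B + 2 * C * t) t := by
      refine (((hasDerivAt_id' t).const_mul B).add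
        ((hasDerivAt_pow 2 t).const_mul C)).congr_deriv ?_
      norm_num
      ring
    exact ((hcomp (ha.differentiable (by simp)) p k t).sub
      (hcomp (hb.differentiable (by simp)) q l t)).sub hquad
  have hd2 : HasDerivAt (deriv h) (deriv (deriv a) p * k * k - deriv (deriv b) q * l * l
      - 2 * C) 0 := by
    rw [show deriv h = _ from funext fun t => (hd t).deriv]
    have h1 := (hcomp ha' p k 0).mul_const k
    have h2 := (hcomp hb' q l 0).mul_const l
    simp only [mul_zero, add_zero] at h1 h2
    exact (h1.sub h2).sub (hline B (2 * C) 0)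
  have hfirst : deriv h 0 = 0 :=
    IsLocalMax.deriv_eq_zero (Filter.Eventually.of_forall hle)
  have hsecond := deriv_deriv_nonpos_of_forall_le hh hle
  rw [hd2.deriv] at hsecond
  rw [(hd 0).deriv] at hfirst
  simp only [mul_zero, add_zero] at hfirst
  constructor <;> linarith

theorem nrm_nonneg (p : ℝ × ℝ) : 0 ≤ nrm p := Real.sqrt_nonneg _

theorem nrm_sq (p : ℝ × ℝ) : nrm p ^ 2 = p.1 ^ 2 + p.2 ^ 2 :=
  Real.sq_sqrt (by positivity)

theorem continuous_nrm : Continuous nrm := by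
  unfold nrm
  fun_prop

/-- The quadratically penalised doubling functional of a function of linear growth attains
its maximum. -/
theorem exists_max_doubling {u : ℝ × ℝ → ℝ} (hu : Continuous u) {A B : ℝ}
    (hA : 0 ≤ A) (hB : 0 ≤ B) (hgrowth : ∀ y, |u y| ≤ A * nrm y + B) {M ε : ℝ} (hM : 0 ≤ M)
    (hε : 0 < ε) (z₀ : (ℝ × ℝ) × (ℝ × ℝ))
    (hz₀ : 0 ≤ u z₀.1 - u z₀.2 - M * nrm (z₀.1 - z₀.2) - ε * (nrm z₀.1 ^ 2 + nrm z₀.2 ^ 2)) :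
    ∃ z : (ℝ × ℝ) × (ℝ × ℝ), ∀ w : (ℝ × ℝ) × (ℝ × ℝ),
      u w.1 - u w.2 - M * nrm (w.1 - w.2) - ε * (nrm w.1 ^ 2 + nrm w.2 ^ 2) ≤
        u z.1 - u z.2 - M * nrm (z.1 - z.2) - ε * (nrm z.1 ^ 2 + nrm z.2 ^ 2) := by
  have hcont : Continuous fun w : (ℝ × ℝ) × (ℝ × ℝ) =>
      u w.1 - u w.2 - M * nrm (w.1 - w.2) - ε * (nrm w.1 ^ 2 + nrm w.2 ^ 2) := by
    have := continuous_nrm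
    fun_prop
  refine hcont.exists_forall_ge' z₀ ?_
  filter_upwards [(tendsto_norm_cocompact_atTop (E := (ℝ × ℝ) × (ℝ × ℝ))).eventually_ge_atTop
    (max 1 (2 * (A + B) / ε))] with w hw
  refine le_trans ?_ hz₀
  set s := Real.sqrt (nrm w.1 ^ 2 + nrm w.2 ^ 2) with hs
  have hs2 : s ^ 2 = nrm w.1 ^ 2 + nrm w.2 ^ 2 := Real.sq_sqrt (by positivity)
  have h1 : nrm w.1 ≤ s := Real.le_sqrt_of_sq_le (by nlinarith [sq_nonneg (nrm w.2)])
  have h2 : nrm w.2 ≤ s := Real.le_sqrt_of_sq_le (by nlinarith [sq_nonneg (nrm w.1)])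
  have hle : ∀ p : ℝ × ℝ, ‖p‖ ≤ nrm p := fun p =>
    max_le (Real.abs_le_sqrt (by nlinarith [sq_nonneg p.2]))
      (Real.abs_le_sqrt (by nlinarith [sq_nonneg p.1]))
  have hws : ‖w‖ ≤ s := max_le ((hle _).trans h1) ((hle _).trans h2)
  have hs_one : 1 ≤ s := (le_max_left _ _).trans (hw.trans hws)
  have hs_big : 2 * (A + B) ≤ s * ε :=
    (div_le_iff₀ hε).1 ((le_max_right _ _).trans (hw.trans hws))
  have hu1 := (abs_le.1 (hgrowth w.1)).2
  have hu2 := (abs_le.1 (hgrowth w.2)).1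
  have hA1 := mul_le_mul_of_nonneg_left h1 hA
  have hA2 := mul_le_mul_of_nonneg_left h2 hA
  have hMn := mul_nonneg hM (nrm_nonneg (w.1 - w.2))
  have hBs := mul_le_mul_of_nonneg_left hs_one hB
  have hss := mul_le_mul_of_nonneg_right hs_big (zero_le_one.trans hs_one)
  rw [← hs2]
  nlinarith

/-- At a maximum of the doubling functional with quadratic coupling `K |x - y|²` and quadratic
penalisation, the Grushin–Ornstein–Uhlenbeck operator satisfies a one-sided comparison. -/
theorem GOU_sub_ge_of_max {u : ℝ × ℝ → ℝ} (hu : ContDiff ℝ 2 u) (α K ε : ℝ) (x y : ℝ × ℝ)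
    (hmax : ∀ a b c d : ℝ,
      u (a, b) - u (c, d) - K * ((a - c) ^ 2 + (b - d) ^ 2) - ε * (a ^ 2 + b ^ 2 + c ^ 2 + d ^ 2) ≤
      u x - u y - K * ((x.1 - y.1) ^ 2 + (x.2 - y.2) ^ 2)
        - ε * (x.1 ^ 2 + x.2 ^ 2 + y.1 ^ 2 + y.2 ^ 2)) :
    2 * K * (α * ((x.1 - y.1) ^ 2 + (x.2 - y.2) ^ 2) - (x.1 - y.1) ^ 2)
      + 2 * ε * (α * (x.1 ^ 2 + x.2 ^ 2 + y.1 ^ 2 + y.2 ^ 2) - (x.1 ^ 2 + y.1 ^ 2) - 2)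
      ≤ GOU α u x - GOU α u y := by
  obtain ⟨x₁, x₂⟩ := x
  obtain ⟨y₁, y₂⟩ := y
  have hfst : ∀ s, ContDiff ℝ 2 fun t => u (t, s) := fun s => by fun_prop
  have hsnd : ∀ s, ContDiff ℝ 2 fun t => u (s, t) := fun s => by fun_prop
  dsimp only at hmax ⊢
  obtain ⟨hx1, -⟩ := optimality_of_quadratic_bound (hfst x₂) (hfst y₂) x₁ y₁ 1 0
    (2 * K * (x₁ - y₁) + 2 * ε * x₁) (K + ε)
    (fun t => by linear_combination hmax (x₁ + 1 * t) x₂ (y₁ + 0 * t) y₂)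
  obtain ⟨hy1, -⟩ := optimality_of_quadratic_bound (hfst x₂) (hfst y₂) x₁ y₁ 0 1
    (-2 * K * (x₁ - y₁) + 2 * ε * y₁) (K + ε)
    (fun t => by linear_combination hmax (x₁ + 0 * t) x₂ (y₁ + 1 * t) y₂)
  obtain ⟨hx2, -⟩ := optimality_of_quadratic_bound (hsnd x₁) (hsnd y₁) x₂ y₂ 1 0
    (2 * K * (x₂ - y₂) + 2 * ε * x₂) (K + ε)
    (fun t => by linear_combination hmax x₁ (x₂ + 1 * t) y₁ (y₂ + 0 * t))
  obtain ⟨hy2, -⟩ := optimality_of_quadratic_bound (hsnd x₁) (hsnd y₁) x₂ y₂ 0 1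
    (-2 * K * (x₂ - y₂) + 2 * ε * y₂) (K + ε)
    (fun t => by linear_combination hmax x₁ (x₂ + 0 * t) y₁ (y₂ + 1 * t))
  obtain ⟨-, h11⟩ := optimality_of_quadratic_bound (hfst x₂) (hfst y₂) x₁ y₁ 1 1
    (2 * ε * (x₁ + y₁)) (2 * ε)
    (fun t => by linear_combination hmax (x₁ + 1 * t) x₂ (y₁ + 1 * t) y₂)
  obtain ⟨-, h22⟩ := optimality_of_quadratic_bound (hsnd x₁) (hsnd y₁) x₂ y₂ x₁ y₁
    (2 * K * (x₂ - y₂) * (x₁ - y₁) + 2 * ε * (x₂ * x₁ + y₂ * y₁))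
    (K * (x₁ - y₁) ^ 2 + ε * (x₁ ^ 2 + y₁ ^ 2))
    (fun t => by linear_combination hmax x₁ (x₂ + x₁ * t) y₁ (y₂ + y₁ * t))
  simp only [GOU, pd11, pd22, pd1, pd2]
  linear_combination h11 + h22 - α * x₁ * hx1 - α * x₂ * hx2 - α * y₁ * hy1 - α * y₂ * hy2

/-- Global Lipschitz continuity of the approximated corrector: if `α > 1`,
`F` is `L`-Lipschitz and `u` solves `δu − Δ_G u + αy·∇u = F` with growth
`|u(y)| ≤ C₀(|y| + 1/δ)`, then `u` is `L̄`-Lipschitz for every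
`L̄ > L/(α−1)`, uniformly in `δ`. -/
theorem approx_corrector_lipschitz (α δ L : ℝ) (hα : 1 < α) (hδ : 0 < δ)
    (hL : 0 ≤ L) (F : ℝ × ℝ → ℝ)
    (hF : ∀ x y : ℝ × ℝ, |F x - F y| ≤ L * nrm (x - y))
    (u : ℝ × ℝ → ℝ) (hu : ContDiff ℝ 2 u)
    (C₀ : ℝ) (hC₀ : 0 < C₀)
    (hgrowth : ∀ y : ℝ × ℝ, |u y| ≤ C₀ * (nrm y + 1 / δ))
    (hpde : ∀ y : ℝ × ℝ, δ * u y + GOU α u y = F y) :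
    ∀ L' : ℝ, L / (α - 1) < L' →
      ∀ x y : ℝ × ℝ, |u x - u y| ≤ L' * nrm (x - y) := by
  intro L' hL' x₀ y₀
  have hα' : 0 < α - 1 := sub_pos.2 hα
  have hL'0 : 0 < L' := (div_nonneg hL hα'.le).trans_lt hL'
  have hLL : L ≤ L' * (α - 1) := ((div_lt_iff₀ hα').1 hL').le
  have hone_sided : ∀ x₀ y₀ : ℝ × ℝ, u x₀ - u y₀ ≤ L' * nrm (x₀ - y₀) := by
    intro x₀ y₀
    by_contra! hcon
    set m := u x₀ - u y₀ - L' * nrm (x₀ - y₀) with hm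
    have hm0 : 0 < m := sub_pos.2 hcon
    set Q := nrm x₀ ^ 2 + nrm y₀ ^ 2 with hQ
    have hQ0 : 0 ≤ Q := by positivity
    obtain ⟨ε, hε, hεQ, hεδ⟩ : ∃ ε : ℝ, 0 < ε ∧ ε * Q ≤ m / 2 ∧ 4 * ε < δ * (m / 2) := by
      refine ⟨min (m / (2 * (Q + 1))) (δ * m / 16), by positivity, ?_, ?_⟩
      · calc _ ≤ m / (2 * (Q + 1)) * (Q + 1) := by
              gcongr
              · exact min_le_left _ _
              · linarith
          _ = m / 2 := by field_simp
      · have := min_le_right (m / (2 * (Q + 1))) (δ * m / 16)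
        have := mul_pos hδ hm0
        linarith
    obtain ⟨⟨x, y⟩, hz⟩ := exists_max_doubling hu.continuous (A := C₀) (B := C₀ * (1 / δ))
      hC₀.le (by positivity) (fun y => (hgrowth y).trans_eq (mul_add _ _ _)) hL'0.le hε (x₀, y₀)
      (by dsimp only; linarith)
    dsimp only at hz
    set r := nrm (x - y) with hr
    have hval : m / 2 ≤ u x - u y - L' * r - ε * (nrm x ^ 2 + nrm y ^ 2) := by
      linarith [hz (x₀, y₀)]
    have hpen : 0 ≤ ε * (nrm x ^ 2 + nrm y ^ 2) := by positivity
    have hr0 : 0 < r := by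
      refine (nrm_nonneg _).lt_of_ne fun h => ?_
      have hsq := nrm_sq (x - y)
      rw [← h] at hsq
      have hxy : x = y := by
        apply Prod.ext <;> simp only [Prod.fst_sub, Prod.snd_sub] at hsq <;> nlinarith
      have huxy : u x = u y := congrArg u hxy
      rw [hr.trans h.symm, huxy] at hval
      linarith
    have hr2 : r ^ 2 = (x.1 - y.1) ^ 2 + (x.2 - y.2) ^ 2 := nrm_sq (x - y)
    set K := L' / (2 * r) with hK
    have hKr : 2 * K * r = L' := by rw [hK]; field_simp
    have hK0 : 0 < K := by positivity
    have hcmp := GOU_sub_ge_of_max hu α K ε x y (fun a b c d => by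
      have h1 := hz ((a, b), (c, d))
      have h2 := nrm_sq ((a, b) - (c, d))
      simp only [nrm_sq] at h1
      simp only [Prod.fst_sub, Prod.snd_sub] at h2
      have h3 := mul_nonneg hK0.le (sq_nonneg (nrm ((a, b) - (c, d)) - r))
      rw [← hr2, ← h2]
      rw [← hKr] at h1
      linear_combination h1 + h3)
    have hFxy := (abs_le.1 (hF x y)).2
    rw [← hpde x, ← hpde y, ← hr] at hFxy
    rw [← hr2] at hcmp
    have hd : δ * (m / 2) ≤ δ * (u x - u y) := by
      gcongr
      have := mul_pos hL'0 hr0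
      linarith
    have hKx : 2 * K * (x.1 - y.1) ^ 2 ≤ L' * r := by
      rw [← hKr]
      nlinarith [mul_nonneg hK0.le (sq_nonneg (x.2 - y.2))]
    have hKα : 2 * K * (α * r ^ 2) = α * (L' * r) := by rw [← hKr]; ring
    have hLr := mul_le_mul_of_nonneg_right hLL hr0.le
    have hε1 : 0 ≤ ε * (α - 1) * (x.1 ^ 2 + y.1 ^ 2) := by positivity
    have hε2 : 0 ≤ ε * α * (x.2 ^ 2 + y.2 ^ 2) := by positivity
    linarith
  rw [abs_le]
  have hsymm : nrm (y₀ - x₀) = nrm (x₀ - y₀) := by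
    simp only [nrm, Prod.fst_sub, Prod.snd_sub]
    ring_nf
  have := hone_sided y₀ x₀
  rw [hsymm] at this
  exact ⟨by linarith, hone_sided x₀ y₀⟩
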